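/- If P and Q are polyhedra in ℝ^D with E nonempty, then 1 − 1/κ*² ≤ max_{x,y ∈ ℝ^D} c_F(aff₀(P_x), aff₀(Q_y))², where the maximum is over x, y for which the faces P_x and Q_y are nonempty. -/

import Mathlib

open scoped RealInnerProductSpace Pointwise
open Metric Filter

noncomputable section

/-- Distance between two sets. -/
def sDist {X : Type*} [MetricSpace X] (K₁ K₂ : Set X) : ℝ :=
  sInf (Set.image2 dist K₁ K₂)

/-- `y` is the nearest-point projection of `x` onto `C`. -/
def IsProjOn {X : Type*} [MetricSpace X] (C : Set X) (x y : X) : Prop :=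
  y ∈ C ∧ ∀ z ∈ C, dist x y ≤ dist x z

/-- A polyhedron: the intersection of finitely many halfspaces. -/
def IsPolyhedron {H : Type*} [NormedAddCommGroup H] [InnerProductSpace ℝ H]
    (P : Set H) : Prop :=
  ∃ (n : ℕ) (a : Fin n → H) (b : Fin n → ℝ), P = {x | ∀ i, ⟪a i, x⟫ ≤ b i}

/-- The face of `P` in direction `x`: the set of maximizers of `⟪x, ·⟫` over `P`. -/
def face {H : Type*} [NormedAddCommGroup H] [InnerProductSpace ℝ H]
    (P : Set H) (x : H) : Set H :=
  {p ∈ P | ∀ q ∈ P, ⟪x, q⟫ ≤ ⟪x, p⟫}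

/-- `aff₀ C`: the affine hull of `C` translated to contain the origin,
as a linear subspace. -/
def aff0 {H : Type*} [NormedAddCommGroup H] [InnerProductSpace ℝ H]
    (C : Set H) : Submodule ℝ H :=
  (affineSpan ℝ C).direction

/-- The cosine of the Friedrichs angle between two subspaces. -/
def friedrichs {H : Type*} [NormedAddCommGroup H] [InnerProductSpace ℝ H]
    (U V : Submodule ℝ H) : ℝ :=
  sSup {t | ∃ u ∈ U ⊓ (U ⊓ V)ᗮ, ∃ v ∈ V ⊓ (U ⊓ V)ᗮ,
    ‖u‖ ≤ 1 ∧ ‖v‖ ≤ 1 ∧ t = ⟪u, v⟫}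

section Polyhedra

variable {H : Type*} [NormedAddCommGroup H] [InnerProductSpace ℝ H] {n k : ℕ}

/-- The polyhedron of solutions of the system `⟪a i, x⟫ ≤ b i`. -/
def halfspaces (a : Fin n → H) (b : Fin n → ℝ) : Set H := {x | ∀ i, ⟪a i, x⟫ ≤ b i}

/-- The constraints that hold with equality at `p`. -/
def activeSet (a : Fin n → H) (b : Fin n → ℝ) (p : H) : Set (Fin n) := {i | ⟪a i, p⟫ = b i}

/-- The cone cut out by the homogeneous constraints with index in `I`. -/
def constraintCone (a : Fin n → H) (I : Set (Fin n)) : Set H := {y | ∀ i ∈ I, ⟪a i, y⟫ ≤ 0}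

/-- The subspace orthogonal to all the constraints that are active at `p`. -/
def activeOrthogonal (a : Fin n → H) (b : Fin n → ℝ) (p : H) : Submodule ℝ H where
  carrier := {y | ∀ i ∈ activeSet a b p, ⟪a i, y⟫ = 0}
  add_mem' := by
    intro x y hx hy i hi
    rw [inner_add_right, hx i hi, hy i hi, add_zero]
  zero_mem' := by
    intro i _
    exact inner_zero_right _
  smul_mem' := by
    intro c x hx i hi
    rw [real_inner_smul_right, hx i hi, mul_zero]

theorem mem_activeOrthogonal {a : Fin n → H} {b : Fin n → ℝ} {p y : H} :
    y ∈ activeOrthogonal a b p ↔ ∀ i, ⟪a i, p⟫ = b i → ⟪a i, y⟫ = 0 := Iff.rfl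

theorem eventually_slack_lt (α β b : Fin n → ℝ) :
    ∀ᶠ s : ℝ in nhdsWithin 0 (Set.Ioi 0), ∀ i, α i < b i → α i + s * β i < b i := by
  refine eventually_all.2 fun i => ?_
  by_cases h : α i < b i
  · have hc : Tendsto (fun s : ℝ => α i + s * β i) (nhds 0) (nhds (α i + 0 * β i)) :=
      Continuous.tendsto (by fun_prop) 0
    have hlt : α i + 0 * β i < b i := by simpa using h
    filter_upwards [nhdsWithin_le_nhds (hc.eventually_lt_const hlt)] with s hs _
    exact hs
  · exact Eventually.of_forall fun s hs => absurd hs h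

theorem eventually_mem_halfspaces {a : Fin n → H} {b : Fin n → ℝ} {e y : H}
    (he : e ∈ halfspaces a b) (hy : y ∈ constraintCone a (activeSet a b e)) :
    ∀ᶠ s : ℝ in nhdsWithin 0 (Set.Ioi 0), e + s • y ∈ halfspaces a b := by
  filter_upwards [eventually_slack_lt (fun i => ⟪a i, e⟫) (fun i => ⟪a i, y⟫) b,
    self_mem_nhdsWithin] with s hs hs0 i
  rw [inner_add_right, real_inner_smul_right]
  rcases (he i).lt_or_eq with h | h
  · exact (hs i h).le
  · nlinarith [hy i h, mul_nonneg (le_of_lt hs0) (neg_nonneg.2 (hy i h))]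

theorem eventually_activeOrthogonal {a : Fin n → H} {b : Fin n → ℝ} {e : H} (u : H)
    (he : e ∈ halfspaces a b) :
    ∀ᶠ s : ℝ in nhdsWithin 0 (Set.Ioi 0), ∀ y, y ∈ activeOrthogonal a b (e + s • u) ↔
      ∀ i ∈ activeSet a b e, ⟪a i, u⟫ = 0 → ⟪a i, y⟫ = 0 := by
  filter_upwards [eventually_slack_lt (fun i => ⟪a i, e⟫) (fun i => ⟪a i, u⟫) b,
    self_mem_nhdsWithin] with s hs hs0 y
  have hs0' : s ≠ 0 := ne_of_gt hs0
  rw [mem_activeOrthogonal]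
  refine forall_congr' fun i => ?_
  rw [inner_add_right, real_inner_smul_right, ← and_imp]
  refine imp_congr_left ?_
  constructor
  · intro h
    have h1 : ⟪a i, e⟫ = b i := by
      rcases (he i).lt_or_eq with h' | h'
      · exact absurd h (hs i h').ne
      · exact h'
    refine ⟨h1, ?_⟩
    have : s * ⟪a i, u⟫ = 0 := by linarith
    simpa [hs0'] using this
  · rintro ⟨h1, h2⟩
    rw [h2, mul_zero, add_zero]
    exact h1

theorem eventually_add_smul_mem_constraintCone {a : Fin n → H} {I : Set (Fin n)} {u w : H}
    (hu : u ∈ constraintCone a I) (hw : ∀ i ∈ I, ⟪a i, u⟫ = 0 → ⟪a i, w⟫ = 0) :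
    ∀ᶠ t : ℝ in nhdsWithin 0 (Set.Ioi 0), u + t • w ∈ constraintCone a I := by
  filter_upwards [eventually_slack_lt (fun i => ⟪a i, u⟫) (fun i => ⟪a i, w⟫) (fun _ => 0)]
    with t ht i hi
  rw [inner_add_right, real_inner_smul_right]
  rcases (hu i hi).lt_or_eq with h | h
  · exact (ht i h).le
  · rw [hw i hi h, h]
    simp

/-- Every point of a polyhedron lies in a face spanned by the directions orthogonal to the
constraints active at that point. -/
theorem exists_face_aff0_eq {a : Fin n → H} {b : Fin n → ℝ} {p : H}
    (hp : p ∈ halfspaces a b) :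
    ∃ x, (face (halfspaces a b) x).Nonempty ∧
      aff0 (face (halfspaces a b) x) = activeOrthogonal a b p := by
  classical
  set A : Finset (Fin n) := Finset.univ.filter fun i => ⟪a i, p⟫ = b i with hA
  set x : H := ∑ i ∈ A, a i with hx
  have hin : ∀ q, ⟪x, q⟫ = ∑ i ∈ A, ⟪a i, q⟫ := fun q => by rw [hx, sum_inner]
  have hxp : ⟪x, p⟫ = ∑ i ∈ A, b i := by
    rw [hin]
    exact Finset.sum_congr rfl fun i hi => (Finset.mem_filter.1 hi).2
  have hpf : p ∈ face (halfspaces a b) x := by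
    refine ⟨hp, fun q hq => ?_⟩
    rw [hxp, hin]
    exact Finset.sum_le_sum fun i _ => hq i
  refine ⟨x, ⟨p, hpf⟩, ?_⟩
  rw [aff0, direction_affineSpan]
  apply le_antisymm
  · have htight : ∀ q ∈ face (halfspaces a b) x, ∀ i, ⟪a i, p⟫ = b i → ⟪a i, q⟫ = b i := by
      intro q hq i hi
      have h1 : ∑ i ∈ A, ⟪a i, q⟫ = ∑ i ∈ A, b i := by
        apply le_antisymm (Finset.sum_le_sum fun i _ => hq.1 i)
        rw [← hxp, ← hin]
        exact hq.2 p hp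
      exact (Finset.sum_eq_sum_iff_of_le fun i _ => hq.1 i).1 h1 i
        (Finset.mem_filter.2 ⟨Finset.mem_univ i, hi⟩)
    rw [vectorSpan_def, Submodule.span_le]
    rintro _ ⟨q, hq, r, hr, rfl⟩ i hi
    change ⟪a i, q - r⟫ = 0
    rw [inner_sub_right, htight q hq i hi, htight r hr i hi, sub_self]
  · intro y hy
    have hy' : y ∈ constraintCone a (activeSet a b p) := fun i hi => (hy i hi).le
    obtain ⟨s, hs, hs0⟩ :=
      ((eventually_mem_halfspaces hp hy').and self_mem_nhdsWithin).exists
    have hs0' : s ≠ 0 := ne_of_gt hs0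
    have hmem : p + s • y ∈ face (halfspaces a b) x := by
      refine ⟨hs, fun q hq => (hpf.2 q hq).trans (le_of_eq ?_)⟩
      have : ⟪x, y⟫ = 0 := by
        rw [hin]
        exact Finset.sum_eq_zero fun i hi => hy i (Finset.mem_filter.1 hi).2
      rw [inner_add_right, real_inner_smul_right, this, mul_zero, add_zero]
    have h := vsub_mem_vectorSpan ℝ hmem hpf
    have h2 := (vectorSpan ℝ (face (halfspaces a b) x)).smul_mem s⁻¹ h
    simpa [hs0'] using h2

theorem isClosed_halfspaces (a : Fin n → H) (b : Fin n → ℝ) : IsClosed (halfspaces a b) := by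
  simp only [halfspaces, Set.ofPred_forall]
  exact isClosed_iInter fun i => isClosed_le (by fun_prop) continuous_const

theorem convex_halfspaces (a : Fin n → H) (b : Fin n → ℝ) : Convex ℝ (halfspaces a b) := by
  simp only [halfspaces, Set.ofPred_forall]
  exact convex_iInter fun i => convex_halfSpace_le (innerₛₗ ℝ (a i)).isLinear (b i)

end Polyhedra

section Friedrichs

variable {H : Type*} [NormedAddCommGroup H] [InnerProductSpace ℝ H]

theorem bddAbove_friedrichs (U V : Submodule ℝ H) :
    BddAbove {t | ∃ u ∈ U ⊓ (U ⊓ V)ᗮ, ∃ v ∈ V ⊓ (U ⊓ V)ᗮ,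
      ‖u‖ ≤ 1 ∧ ‖v‖ ≤ 1 ∧ t = ⟪u, v⟫} := by
  refine ⟨1, ?_⟩
  rintro t ⟨u, _, v, _, hu, hv, rfl⟩
  exact (real_inner_le_norm u v).trans (mul_le_one₀ hu (norm_nonneg _) hv)

theorem friedrichs_nonneg (U V : Submodule ℝ H) : 0 ≤ friedrichs U V :=
  le_csSup (bddAbove_friedrichs U V)
    ⟨0, Submodule.zero_mem _, 0, Submodule.zero_mem _, by simp, by simp, by simp⟩

theorem friedrichs_comm (U V : Submodule ℝ H) : friedrichs U V = friedrichs V U := by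
  have : ∀ U V : Submodule ℝ H, friedrichs U V ≤ friedrichs V U := by
    intro U V
    refine csSup_le ⟨0, 0, Submodule.zero_mem _, 0, Submodule.zero_mem _,
      by simp, by simp, by simp⟩ ?_
    rintro t ⟨u, hu, v, hv, hu1, hv1, rfl⟩
    refine le_csSup (bddAbove_friedrichs V U) ⟨v, ?_, u, ?_, hv1, hu1, real_inner_comm _ _⟩
    · rwa [inf_comm V U]
    · rwa [inf_comm V U]
  exact le_antisymm (this U V) (this V U)

theorem inner_le_friedrichs_mul_norm [FiniteDimensional ℝ H] {U V : Submodule ℝ H} {u m : H}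
    (hu : u ∈ U) (hu' : u ∈ (U ⊓ V)ᗮ) (hu1 : ‖u‖ = 1) (hm : m ∈ V) :
    ⟪u, m⟫ ≤ friedrichs U V * ‖m‖ := by
  set w : H := (U ⊓ V).starProjection m with hw
  have hwm : w ∈ U ⊓ V := Submodule.starProjection_apply_mem _ _
  have hr : m - w ∈ (U ⊓ V)ᗮ := Submodule.sub_starProjection_mem_orthogonal m
  have hrV : m - w ∈ V := V.sub_mem hm hwm.2
  have h0 : ⟪u, m⟫ = ⟪u, m - w⟫ := by
    rw [inner_sub_right, Submodule.inner_left_of_mem_orthogonal hwm hu', sub_zero]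
  have hn : ‖m - w‖ ≤ ‖m‖ := by
    have h1 : ⟪m - w, w⟫ = 0 := Submodule.inner_left_of_mem_orthogonal hwm hr
    have h2 := norm_add_sq_real (m - w) w
    rw [sub_add_cancel, h1] at h2
    apply le_of_sq_le_sq _ (norm_nonneg _)
    nlinarith [sq_nonneg ‖w‖]
  have hc := friedrichs_nonneg U V
  refine le_trans ?_ (mul_le_mul_of_nonneg_left hn hc)
  rw [h0]
  rcases eq_or_ne (m - w) 0 with h | h
  · rw [h]
    simp
  · have hpos : 0 < ‖m - w‖ := norm_pos_iff.2 h
    have hle : ⟪u, ‖m - w‖⁻¹ • (m - w)⟫ ≤ friedrichs U V := by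
      refine le_csSup (bddAbove_friedrichs U V) ⟨u, ⟨hu, hu'⟩, _, ⟨V.smul_mem _ hrV,
        Submodule.smul_mem _ _ hr⟩, hu1.le, ?_, rfl⟩
      rw [norm_smul, norm_inv, norm_norm, inv_mul_cancel₀ hpos.ne']
    rw [real_inner_smul_right, inv_mul_le_iff₀ hpos] at hle
    linarith

theorem one_sub_norm_sub_sq_le_friedrichs_sq [FiniteDimensional ℝ H] {U V : Submodule ℝ H}
    {u m : H} (hu : u ∈ U) (hu' : u ∈ (U ⊓ V)ᗮ) (hu1 : ‖u‖ = 1) (hm : m ∈ V) :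
    1 - ‖u - m‖ ^ 2 ≤ friedrichs U V ^ 2 := by
  have h := inner_le_friedrichs_mul_norm hu hu' hu1 hm
  rw [norm_sub_sq_real, hu1]
  nlinarith [sq_nonneg (friedrichs U V - ‖m‖)]

end Friedrichs

section LinearRegularity

variable {H : Type*} [NormedAddCommGroup H] [InnerProductSpace ℝ H] {n k : ℕ}

/-- Pairs `(u, m)` with `u` a unit vector in the cone of the constraints `I` and `m` in the cone
of the constraints `J`, such that `u` is in the polar of the intersection of the two cones. -/
def normalPairs (a : Fin n → H) (c : Fin k → H) (I : Set (Fin n)) (J : Set (Fin k)) :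
    Set (H × H) :=
  {z | z.1 ∈ constraintCone a I ∧ z.2 ∈ constraintCone c J ∧ ‖z.1‖ = 1 ∧
    ∀ y ∈ constraintCone a I ∩ constraintCone c J, ⟪z.1, y⟫ ≤ 0}

theorem isClosed_constraintCone (a : Fin n → H) (I : Set (Fin n)) :
    IsClosed (constraintCone a I) := by
  simp only [constraintCone, Set.ofPred_forall]
  exact isClosed_iInter fun i => isClosed_iInter fun _ =>
    isClosed_le (by fun_prop) continuous_const

theorem isClosed_normalPairs (a : Fin n → H) (c : Fin k → H) (I : Set (Fin n))
    (J : Set (Fin k)) : IsClosed (normalPairs a c I J) := by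
  refine ((isClosed_constraintCone a I).preimage continuous_fst).inter
    (((isClosed_constraintCone c J).preimage continuous_snd).inter
      ((isClosed_eq (by fun_prop) continuous_const).inter ?_))
  have h : IsClosed {z : H × H | ∀ y ∈ constraintCone a I ∩ constraintCone c J,
      ⟪z.1, y⟫ ≤ 0} := by
    simp only [Set.ofPred_forall]
    exact isClosed_iInter fun y => isClosed_iInter fun _ =>
      isClosed_le (by fun_prop) continuous_const
  exact h

/-- The union of the sets `normalPairs` for the active constraints at the points common to
two polyhedra. -/
def commonNormalPairs (a : Fin n → H) (b : Fin n → ℝ) (c : Fin k → H) (d : Fin k → ℝ) :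
    Set (H × H) :=
  {z | ∃ e ∈ halfspaces a b ∩ halfspaces c d,
    z ∈ normalPairs a c (activeSet a b e) (activeSet c d e)}

theorem isClosed_commonNormalPairs (a : Fin n → H) (b : Fin n → ℝ) (c : Fin k → H)
    (d : Fin k → ℝ) : IsClosed (commonNormalPairs a b c d) := by
  have : commonNormalPairs a b c d =
      ⋃ I ∈ (fun e => (activeSet a b e, activeSet c d e)) '' (halfspaces a b ∩ halfspaces c d),
        normalPairs a c I.1 I.2 := by
    ext z
    simp [commonNormalPairs]
  rw [this]
  exact (Set.toFinite _).isClosed_biUnion fun I _ => isClosed_normalPairs a c I.1 I.2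

theorem exists_min_norm_sub [FiniteDimensional ℝ H] {a : Fin n → H} {b : Fin n → ℝ}
    {c : Fin k → H} {d : Fin k → ℝ} (h : (commonNormalPairs a b c d).Nonempty) :
    ∃ z ∈ commonNormalPairs a b c d, ∀ y ∈ commonNormalPairs a b c d,
      ‖z.1 - z.2‖ ≤ ‖y.1 - y.2‖ := by
  have : ProperSpace H := FiniteDimensional.proper ℝ H
  obtain ⟨z₀, hz₀⟩ := h
  have hnorm : ∀ z ∈ commonNormalPairs a b c d, ‖z.1‖ = 1 := fun z ⟨_, _, hz⟩ => hz.2.2.1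
  obtain ⟨z, hz, hmin⟩ := ContinuousOn.exists_isMinOn'
    (f := fun z : H × H => ‖z.1 - z.2‖) (by fun_prop) (isClosed_commonNormalPairs a b c d) hz₀
    (by
      rw [eventually_inf_principal]
      filter_upwards [(tendsto_norm_cocompact_atTop (E := H × H)).eventually_gt_atTop
        (‖z₀.1 - z₀.2‖ + 1)] with z hz hzR
      have h1 := hnorm z hzR
      have h2 : ‖z.2‖ ≤ ‖z.1 - z.2‖ + ‖z.1‖ := by
        have := norm_sub_norm_le z.2 z.1
        rw [norm_sub_rev] at this
        linarith
      rw [Prod.norm_def, lt_max_iff] at hz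
      rcases hz with hz | hz
      · linarith [norm_nonneg (z₀.1 - z₀.2)]
      · linarith)
  exact ⟨z, hz, fun y hy => hmin hy⟩

theorem exists_normalized_mem_commonNormalPairs [FiniteDimensional ℝ H] {a : Fin n → H}
    {b : Fin n → ℝ} {c : Fin k → H} {d : Fin k → ℝ}
    (hne : (halfspaces a b ∩ halfspaces c d).Nonempty) {p q : H} (hp : p ∈ halfspaces a b)
    (hpE : p ∉ halfspaces a b ∩ halfspaces c d) (hq : q ∈ halfspaces c d) :
    ∃ e ∈ halfspaces a b ∩ halfspaces c d, 0 < ‖p - e‖ ∧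
      (‖p - e‖⁻¹ • (p - e), ‖p - e‖⁻¹ • (q - e)) ∈ commonNormalPairs a b c d := by
  obtain ⟨e, he, hmin⟩ := exists_norm_eq_iInf_of_complete_convex hne
    ((isClosed_halfspaces a b).inter (isClosed_halfspaces c d)).isComplete
    ((convex_halfspaces a b).inter (convex_halfspaces c d)) p
  rw [norm_eq_iInf_iff_real_inner_le_zero
    ((convex_halfspaces a b).inter (convex_halfspaces c d)) he] at hmin
  have hpos : 0 < ‖p - e‖ := by
    rw [norm_pos_iff, sub_ne_zero]
    rintro rfl
    exact hpE he
  have hinv : 0 ≤ ‖p - e‖⁻¹ := inv_nonneg.2 hpos.le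
  refine ⟨e, he, hpos, e, he, ?_, ?_, ?_, ?_⟩
  · intro i hi
    rw [real_inner_smul_right, inner_sub_right, show ⟪a i, e⟫ = b i from hi]
    exact mul_nonpos_of_nonneg_of_nonpos hinv (sub_nonpos.2 (hp i))
  · intro i hi
    rw [real_inner_smul_right, inner_sub_right, show ⟪c i, e⟫ = d i from hi]
    exact mul_nonpos_of_nonneg_of_nonpos hinv (sub_nonpos.2 (hq i))
  · rw [norm_smul, norm_inv, norm_norm, inv_mul_cancel₀ hpos.ne']
  · intro y hy
    obtain ⟨s, ⟨hsa, hsc⟩, hs0⟩ := (((eventually_mem_halfspaces he.1 hy.1).and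
      (eventually_mem_halfspaces he.2 hy.2)).and self_mem_nhdsWithin).exists
    have h := hmin _ ⟨hsa, hsc⟩
    rw [add_sub_cancel_left, real_inner_smul_right] at h
    rw [real_inner_smul_left]
    exact mul_nonpos_of_nonneg_of_nonpos hinv (nonpos_of_mul_nonpos_right h hs0)

/-- At a pair minimizing `‖u - m‖`, the vector `u` has no positive component along a common
direction of the minimal faces of the two cones containing `u` and `m`. -/
theorem inner_nonpos_of_min [FiniteDimensional ℝ H] {a : Fin n → H}
    {b : Fin n → ℝ} {c : Fin k → H} {d : Fin k → ℝ} {e u m w : H}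
    (he : e ∈ halfspaces a b ∩ halfspaces c d)
    (hz : (u, m) ∈ normalPairs a c (activeSet a b e) (activeSet c d e))
    (hpos : 0 < ‖u - m‖)
    (hmin : ∀ y ∈ commonNormalPairs a b c d, ‖u - m‖ ≤ ‖y.1 - y.2‖)
    (hwa : ∀ i ∈ activeSet a b e, ⟪a i, u⟫ = 0 → ⟪a i, w⟫ = 0)
    (hwc : ∀ i ∈ activeSet c d e, ⟪c i, m⟫ = 0 → ⟪c i, w⟫ = 0) : ⟪u, w⟫ ≤ 0 := by
  by_contra! hw
  obtain ⟨hu, hm, hu1, hpolar⟩ := hz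
  simp only at hu hm hu1 hpolar
  obtain ⟨t, ⟨hta, htc⟩, ht0⟩ := (((eventually_add_smul_mem_constraintCone hu hwa).and
    (eventually_add_smul_mem_constraintCone hm hwc)).and self_mem_nhdsWithin).exists
  obtain ⟨s, ⟨hsa, hsc⟩, hs0⟩ := (((eventually_mem_halfspaces he.1 hta).and
    (eventually_mem_halfspaces he.2 htc)).and self_mem_nhdsWithin).exists
  replace ht0 : 0 < t := ht0
  replace hs0 : 0 < s := hs0
  set p := e + s • (u + t • w) with hp
  set q := e + s • (m + t • w) with hq
  have hfar : ∀ e' ∈ halfspaces a b ∩ halfspaces c d, s < ‖p - e'‖ := by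
    intro e' he'
    have h1 : ⟪u, e' - e⟫ ≤ 0 := by
      apply hpolar
      constructor
      · intro i hi
        rw [inner_sub_right, show ⟪a i, e⟫ = b i from hi]
        exact sub_nonpos.2 (he'.1 i)
      · intro i hi
        rw [inner_sub_right, show ⟪c i, e⟫ = d i from hi]
        exact sub_nonpos.2 (he'.2 i)
    have h2 : ⟪u, p - e'⟫ = s * (1 + t * ⟪u, w⟫) - ⟪u, e' - e⟫ := by
      rw [hp]
      simp only [inner_sub_right, inner_add_right, real_inner_smul_right,
        real_inner_self_eq_norm_sq, hu1]
      ring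
    have h3 : ⟪u, p - e'⟫ ≤ ‖p - e'‖ := by
      have := real_inner_le_norm u (p - e')
      rwa [hu1, one_mul] at this
    have h4 : 0 < s * (t * ⟪u, w⟫) := by positivity
    linarith
  have hpE : p ∉ halfspaces a b ∩ halfspaces c d := by
    intro h
    have := hfar p h
    rw [sub_self, norm_zero] at this
    linarith
  obtain ⟨e', he', hpos', hmem⟩ := exists_normalized_mem_commonNormalPairs ⟨e, he⟩ hsa hpE hsc
  have h := hmin _ hmem
  simp only at h
  rw [← smul_sub, sub_sub_sub_cancel_right, norm_smul, norm_inv, norm_norm,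
    show p - q = s • (u - m) by rw [hp, hq, ← sub_eq_zero]; module, norm_smul,
    Real.norm_of_nonneg hs0.le, le_inv_mul_iff₀ hpos'] at h
  have := hfar e' he'
  nlinarith

/-- Two intersecting polyhedra are linearly regular, with a constant controlled by the Friedrichs
angle between the directions of two of their faces. -/
theorem exists_linear_regularity [FiniteDimensional ℝ H] {a : Fin n → H}
    {b : Fin n → ℝ} {c : Fin k → H} {d : Fin k → ℝ}
    (hne : (halfspaces a b ∩ halfspaces c d).Nonempty) :
    ∃ δ : ℝ, 0 < δ ∧ (∀ x ∈ halfspaces a b,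
        δ * infDist x (halfspaces a b ∩ halfspaces c d) ≤ infDist x (halfspaces c d)) ∧
      ∃ p ∈ halfspaces a b, ∃ q ∈ halfspaces c d,
        1 - δ ^ 2 ≤ friedrichs (activeOrthogonal a b p) (activeOrthogonal c d q) ^ 2 := by
  rcases (commonNormalPairs a b c d).eq_empty_or_nonempty with hR | hR
  · obtain ⟨e, he⟩ := hne
    refine ⟨1, one_pos, fun x hx => ?_, e, he.1, e, he.2, ?_⟩
    swap
    · rw [one_pow, sub_self]
      exact sq_nonneg _
    by_cases hxE : x ∈ halfspaces a b ∩ halfspaces c d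
    · rw [infDist_zero_of_mem hxE, mul_zero]
      exact infDist_nonneg
    · obtain ⟨_, _, _, h⟩ := exists_normalized_mem_commonNormalPairs ⟨e, he⟩ hx hxE he.2
      rw [hR] at h
      exact h.elim
  · obtain ⟨⟨u, m⟩, ⟨e, he, hz⟩, hmin⟩ := exists_min_norm_sub hR
    simp only at hmin
    have hz' := hz
    obtain ⟨hu, hm, hu1, hpolar⟩ := hz'
    simp only at hu hm hu1 hpolar
    have hpos : 0 < ‖u - m‖ := by
      rw [norm_pos_iff, sub_ne_zero]
      rintro rfl
      have := hpolar u ⟨hu, hm⟩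
      rw [real_inner_self_eq_norm_sq, hu1] at this
      norm_num at this
    refine ⟨‖u - m‖, hpos, fun x hx => ?_, ?_⟩
    · by_cases hxE : x ∈ halfspaces a b ∩ halfspaces c d
      · rw [infDist_zero_of_mem hxE, mul_zero]
        exact infDist_nonneg
      · rw [le_infDist ⟨e, he.2⟩]
        intro y hy
        obtain ⟨e', he', hpos', hmem⟩ := exists_normalized_mem_commonNormalPairs hne hx hxE hy
        have h := hmin _ hmem
        simp only at h
        rw [← smul_sub, sub_sub_sub_cancel_right, norm_smul, norm_inv, norm_norm,
          le_inv_mul_iff₀ hpos', ← dist_eq_norm x y] at h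
        have h2 : infDist x (halfspaces a b ∩ halfspaces c d) ≤ ‖x - e'‖ := by
          rw [← dist_eq_norm]
          exact infDist_le_dist_of_mem he'
        nlinarith
    · obtain ⟨s, ⟨hsa, hsa'⟩, hsc, hsc'⟩ := (((eventually_mem_halfspaces he.1 hu).and
        (eventually_activeOrthogonal u he.1)).and ((eventually_mem_halfspaces he.2 hm).and
        (eventually_activeOrthogonal m he.2))).exists
      refine ⟨_, hsa, _, hsc, one_sub_norm_sub_sq_le_friedrichs_sq
        ((hsa' u).2 fun _ _ h => h) ?_ hu1 ((hsc' m).2 fun _ _ h => h)⟩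
      rw [Submodule.mem_orthogonal']
      intro w hw
      have key : ∀ w ∈ activeOrthogonal a b (e + s • u) ⊓ activeOrthogonal c d (e + s • m),
          ⟪u, w⟫ ≤ 0 := fun w hw =>
        inner_nonpos_of_min he hz hpos hmin ((hsa' w).1 hw.1) ((hsc' w).1 hw.2)
      have h1 := key w hw
      have h2 := key (-w) (Submodule.neg_mem _ hw)
      rw [inner_neg_right] at h2
      linarith

end LinearRegularity

section ProjectionGap

variable {H : Type*} [NormedAddCommGroup H] [InnerProductSpace ℝ H]

theorem image_sub_halfspaces {k : ℕ} (c : Fin k → H) (d : Fin k → ℝ) (v : H) :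
    (fun q => q - v) '' halfspaces c d = halfspaces c (fun i => d i - ⟪c i, v⟫) := by
  ext x
  simp only [halfspaces, Set.mem_image, Set.mem_ofPred_eq]
  constructor
  · rintro ⟨q, hq, rfl⟩ i
    rw [inner_sub_right]
    linarith [hq i]
  · intro h
    refine ⟨x + v, fun i => ?_, add_sub_cancel_right x v⟩
    rw [inner_add_right]
    linarith [h i]

theorem activeOrthogonal_add {k : ℕ} (c : Fin k → H) (d : Fin k → ℝ) (q v : H) :
    activeOrthogonal c d (q + v) = activeOrthogonal c (fun i => d i - ⟪c i, v⟫) q := by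
  ext y
  simp only [mem_activeOrthogonal, inner_add_right, eq_sub_iff_add_eq]

theorem sDist_eq_norm {G : Type*} [NormedAddCommGroup G] {P Q : Set G} (hP : P.Nonempty)
    (hQ : Q.Nonempty) {v : G} (hv : IsProjOn (closure (Q - P)) 0 v) : sDist P Q = ‖v‖ := by
  have hlow : ∀ p ∈ P, ∀ q ∈ Q, ‖v‖ ≤ dist p q := by
    intro p hp q hq
    have := hv.2 (q - p) (subset_closure (Set.sub_mem_sub hq hp))
    rwa [dist_zero_left, dist_zero_left, ← dist_eq_norm, dist_comm] at this
  have hbdd : BddBelow (Set.image2 dist P Q) := by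
    refine ⟨‖v‖, ?_⟩
    rintro _ ⟨p, hp, q, hq, rfl⟩
    exact hlow p hp q hq
  apply le_antisymm
  · refine le_of_forall_pos_le_add fun ε hε => ?_
    obtain ⟨_, ⟨q, hq, p, hp, rfl⟩, h⟩ := Metric.mem_closure_iff.1 hv.1 ε hε
    refine (csInf_le hbdd ⟨p, hp, q, hq, rfl⟩).trans ?_
    have h1 : dist p q = ‖q - p‖ := by rw [dist_comm, dist_eq_norm]
    have h2 := norm_sub_norm_le (q - p) v
    rw [norm_sub_rev (q - p) v, ← dist_eq_norm v] at h2
    simp only at h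
    linarith
  · refine le_csInf (hP.image2 hQ) ?_
    rintro _ ⟨p, hp, q, hq, rfl⟩
    exact hlow p hp q hq

theorem IsProjOn.eq_of_norm_le {C : Set H} (hC : Convex ℝ C) {v w : H} (hv : IsProjOn C 0 v)
    (hw : w ∈ C) (h : ‖w‖ ≤ ‖v‖) : w = v := by
  have hmid : (1 / 2 : ℝ) • v + (1 / 2 : ℝ) • w ∈ C :=
    hC hv.1 hw (by norm_num) (by norm_num) (by norm_num)
  have h1 := hv.2 _ hmid
  rw [dist_zero_left, dist_zero_left, ← smul_add, norm_smul, Real.norm_of_nonneg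
    (by norm_num)] at h1
  have h2 := parallelogram_law_with_norm ℝ v w
  have h3 : ‖v - w‖ * ‖v - w‖ ≤ 0 := by
    nlinarith [norm_nonneg v, norm_nonneg w, norm_nonneg (v + w)]
  have h4 : ‖v - w‖ = 0 := by nlinarith [norm_nonneg (v - w)]
  exact (sub_eq_zero.1 (norm_eq_zero.1 h4)).symm

/-- The points of `P` nearest to `Q` are those of `P ∩ (Q - v)`, where `v` is the gap vector. -/
theorem nearest_points_eq_inter [FiniteDimensional ℝ H] {P Q : Set H} (hP : P.Nonempty)
    (hQ : Q.Nonempty) (hPc : Convex ℝ P) (hQc : Convex ℝ Q) (hQcl : IsClosed Q) {v : H}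
    (hv : IsProjOn (closure (Q - P)) 0 v) :
    {p ∈ P | infDist p Q = sDist P Q} = P ∩ (fun q => q - v) '' Q := by
  have : ProperSpace H := FiniteDimensional.proper ℝ H
  rw [sDist_eq_norm hP hQ hv]
  ext p
  constructor
  · rintro ⟨hp, h⟩
    obtain ⟨q, hq, hqd⟩ := hQcl.exists_infDist_eq_dist hQ p
    refine ⟨hp, q, hq, ?_⟩
    have : q - p = v := by
      refine hv.eq_of_norm_le (hQc.sub hPc).closure (subset_closure (Set.sub_mem_sub hq hp)) ?_
      rw [← dist_eq_norm, dist_comm, ← hqd, h]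
    simp [← this]
  · rintro ⟨hp, q, hq, rfl⟩
    refine ⟨hp, le_antisymm ?_ ?_⟩
    · refine (infDist_le_dist_of_mem hq).trans (le_of_eq ?_)
      rw [dist_eq_norm, sub_sub_cancel_left, norm_neg]
    · rw [le_infDist hQ]
      intro y hy
      have := hv.2 (y - (q - v)) (subset_closure (Set.sub_mem_sub hy hp))
      rwa [dist_zero_left, dist_zero_left, ← dist_eq_norm, dist_comm] at this

end ProjectionGap

theorem stmt3 {D : ℕ} (P Q : Set (EuclideanSpace ℝ (Fin D)))
    (hPpoly : IsPolyhedron P) (hQpoly : IsPolyhedron Q)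
    (hPne : P.Nonempty) (hQne : Q.Nonempty)
    (v : EuclideanSpace ℝ (Fin D)) (hv : IsProjOn (closure (Q - P)) 0 v)
    (E Q' : Set (EuclideanSpace ℝ (Fin D)))
    (hE : E = {p ∈ P | infDist p Q = sDist P Q})
    (hQ' : Q' = (fun q => q - v) '' Q)
    (hEne : E.Nonempty)
    (hne : ((P ∪ Q') \ E).Nonempty)
    (κ : EuclideanSpace ℝ (Fin D) → ℝ)
    (hκ : ∀ x, κ x = infDist x E / max (infDist x P) (infDist x Q'))
    (κstar : ℝ) (hκstar : κstar = sSup (κ '' ((P ∪ Q') \ E))) :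
    ∃ x y : EuclideanSpace ℝ (Fin D),
      (face P x).Nonempty ∧ (face Q y).Nonempty ∧
      1 - (κstar ^ 2)⁻¹ ≤ friedrichs (aff0 (face P x)) (aff0 (face Q y)) ^ 2 := by
  obtain ⟨n, a, b, hP⟩ := hPpoly
  obtain ⟨k, c, d, hQ⟩ := hQpoly
  change P = halfspaces a b at hP
  change Q = halfspaces c d at hQ
  subst hP hQ
  rw [nearest_points_eq_inter hPne hQne (convex_halfspaces a b) (convex_halfspaces c d)
    (isClosed_halfspaces c d) hv, ← hQ'] at hE
  rw [image_sub_halfspaces] at hQ'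
  set d' : Fin k → ℝ := fun i => d i - ⟪c i, v⟫ with hd'
  subst hQ' hE
  obtain ⟨δ, hδ, hreg, p, hp, q, hq, hang⟩ :
      ∃ δ : ℝ, 0 < δ ∧ (∀ x ∈ halfspaces a b ∪ halfspaces c d',
        δ * infDist x (halfspaces a b ∩ halfspaces c d') ≤
          max (infDist x (halfspaces a b)) (infDist x (halfspaces c d'))) ∧
      ∃ p ∈ halfspaces a b, ∃ q ∈ halfspaces c d',
        1 - δ ^ 2 ≤ friedrichs (activeOrthogonal a b p) (activeOrthogonal c d' q) ^ 2 := by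
    obtain ⟨δ₁, hδ₁, h₁, p₁, hp₁, q₁, hq₁, ha₁⟩ := exists_linear_regularity hEne
    obtain ⟨δ₂, hδ₂, h₂, q₂, hq₂, p₂, hp₂, ha₂⟩ :=
      exists_linear_regularity (Set.inter_comm _ _ ▸ hEne)
    rw [Set.inter_comm] at h₂
    rw [friedrichs_comm] at ha₂
    refine ⟨min δ₁ δ₂, lt_min hδ₁ hδ₂, ?_, ?_⟩
    · rintro x (hx | hx)
      · exact (mul_le_mul_of_nonneg_right (min_le_left _ _) infDist_nonneg).trans
          ((h₁ x hx).trans (le_max_right _ _))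
      · exact (mul_le_mul_of_nonneg_right (min_le_right _ _) infDist_nonneg).trans
          ((h₂ x hx).trans (le_max_left _ _))
    · rcases min_choice δ₁ δ₂ with h | h <;> rw [h]
      · exact ⟨p₁, hp₁, q₁, hq₁, ha₁⟩
      · exact ⟨p₂, hp₂, q₂, hq₂, ha₂⟩
  have hqv : q + v ∈ halfspaces c d := by
    rw [← image_sub_halfspaces] at hq
    obtain ⟨y, hy, rfl⟩ := hq
    simpa using hy
  obtain ⟨x, hx, hxL⟩ := exists_face_aff0_eq hp
  obtain ⟨y, hy, hyL⟩ := exists_face_aff0_eq hqv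
  refine ⟨x, y, hx, hy, ?_⟩
  rw [hxL, hyL, activeOrthogonal_add]
  refine le_trans ?_ hang
  have hEcl : IsClosed (halfspaces a b ∩ halfspaces c d') :=
    (isClosed_halfspaces a b).inter (isClosed_halfspaces c d')
  have hbound : ∀ r ∈ κ '' ((halfspaces a b ∪ halfspaces c d') \
      (halfspaces a b ∩ halfspaces c d')), 0 < r ∧ r ≤ δ⁻¹ := by
    rintro _ ⟨z, ⟨hz, hzE⟩, rfl⟩
    have hpos := (hEcl.notMem_iff_infDist_pos hEne).1 hzE
    have hle := hreg z hz
    have hmax := (mul_pos hδ hpos).trans_le hle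
    rw [hκ]
    refine ⟨div_pos hpos hmax, ?_⟩
    rw [div_le_iff₀ hmax, le_inv_mul_iff₀ hδ]
    exact hle
  have hle : κstar ≤ δ⁻¹ := by
    rw [hκstar]
    exact csSup_le (hne.image κ) fun r hr => (hbound r hr).2
  have hpos : 0 < κstar := by
    obtain ⟨r, hr⟩ := hne.image κ
    rw [hκstar]
    exact (hbound r hr).1.trans_le (le_csSup ⟨δ⁻¹, fun r hr => (hbound r hr).2⟩ hr)
  have hinv : δ ≤ κstar⁻¹ := (le_inv_comm₀ hpos hδ).1 hle
  rw [← inv_pow]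
  have := pow_le_pow_left₀ hδ.le hinv 2
  linarith
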